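/- Let n ∈ F_q[T] be a monic polynomial that is a perfect square. Then Σ_{D ∈ H_{2g+1}} (D/n) = (q^{2g+1}/ζ_A(2)) Π_{P | n} (|P|/(|P|+1)) + O(q^{g+1/2} |n|^ε) for any ε > 0, where the product is over monic irreducible divisors P of n. -/

import Mathlib

open Polynomial Filter Asymptotics
open scoped Classical

variable {Fq : Type} [Field Fq] [Fintype Fq]

/-- Norm of a polynomial: `|f| = q^(deg f)` for `f ≠ 0`, and `|0| = 0`. -/
noncomputable def pnorm (f : Polynomial Fq) : ℝ :=
  if f = 0 then 0 else (Fintype.card Fq : ℝ) ^ f.natDegree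

/-- Monic polynomials of degree `n`. -/
def monicDeg (Fq : Type) [Field Fq] (n : ℕ) : Set (Polynomial Fq) :=
  {f | f.Monic ∧ f.natDegree = n}

/-- `H_{2g+1}`: monic square-free polynomials of degree `2g+1`. -/
def Hset (Fq : Type) [Field Fq] (g : ℕ) : Set (Polynomial Fq) :=
  {D | D.Monic ∧ Squarefree D ∧ D.natDegree = 2 * g + 1}

/-- Quadratic residue symbol `(D/P)` for an irreducible `P`. -/
noncomputable def quadCharP (D P : Polynomial Fq) : ℤ :=
  if P ∣ D then 0 else if ∃ x : Polynomial Fq, P ∣ (x ^ 2 - D) then 1 else -1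

/-- Jacobi-type quadratic residue symbol `(D/n)`, extended multiplicatively over
irreducible factors of `n`. -/
noncomputable def jacobi (D n : Polynomial Fq) : ℤ :=
  ((UniqueFactorizationMonoid.factors n).map (quadCharP D)).prod

/-- The quadratic Dirichlet L-function `L(s, χ_D)` as a finite sum
`Σ_{n=0}^{deg D - 1} (Σ_{f monic, deg f = n} χ_D(f)) q^{-ns}`. -/
noncomputable def Lfun (D : Polynomial Fq) (s : ℂ) : ℂ :=
  ∑ n ∈ Finset.range D.natDegree,
    (∑ᶠ f ∈ monicDeg Fq n, (jacobi D f : ℂ)) * (Fintype.card Fq : ℂ) ^ (-(n : ℂ) * s)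

/-- The central value `L(1/2, χ_D)` as a real number. -/
noncomputable def LhalfR (D : Polynomial Fq) : ℝ :=
  ∑ n ∈ Finset.range D.natDegree,
    (∑ᶠ f ∈ monicDeg Fq n, (jacobi D f : ℝ)) * (Real.sqrt (Fintype.card Fq))⁻¹ ^ n

/-- `a_m = Π_{P | m} |P|/(|P|+1)` over monic irreducible divisors `P` of `m`. -/
noncomputable def am (m : Polynomial Fq) : ℝ :=
  ∏ᶠ (P : Polynomial Fq) (_ : P.Monic ∧ Irreducible P ∧ P ∣ m), pnorm P / (pnorm P + 1)

/-- `d_k(m)`: the number of ordered `k`-tuples of monic polynomials with product `m`. -/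
noncomputable def dfold (k : ℕ) (m : Polynomial Fq) : ℕ :=
  Nat.card {t : Fin k → Polynomial Fq // (∀ i, (t i).Monic) ∧ ∏ i, t i = m}

/-- Möbius function on `F_q[T]`. -/
noncomputable def moebiusP (f : Polynomial Fq) : ℤ :=
  if Squarefree f then (-1) ^ (UniqueFactorizationMonoid.factors f).card else 0

/-- The Dirichlet polynomial `A(D) = Σ_{n monic, deg n ≤ 4g/(15k)} χ_D(n)/√|n|`. -/
noncomputable def AD (k g : ℕ) (D : Polynomial Fq) : ℝ :=
  ∑ᶠ n ∈ {n : Polynomial Fq | n.Monic ∧ n.natDegree ≤ 4 * g / (15 * k)},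
    (jacobi D n : ℝ) / Real.sqrt (pnorm n)

/-- Monic square-free polynomials of degree `N` divisible by no element of `R`. -/
def squarefreeCoprime (R : Finset (Polynomial Fq)) (N : ℕ) : Set (Polynomial Fq) :=
  {D | D ∈ monicDeg Fq N ∧ Squarefree D ∧ ∀ P ∈ R, ¬ P ∣ D}

/-- The square part of a factorization into a square times a square-free element is unique. -/
lemma associated_of_sq_mul_squarefree_eq {K : Type*} [Field K] {a b c d : Polynomial K} (hb : Squarefree b)
    (hd : Squarefree d) (ha : a ≠ 0) (h : a ^ 2 * b = c ^ 2 * d) : Associated a c := by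
  let : GCDMonoid (Polynomial K) := UniqueFactorizationMonoid.toGCDMonoid _
  obtain ⟨a', c', h1, h2, h3⟩ := extract_gcd a c
  set e := gcd a c
  have he : e ≠ 0 := by
    intro h0
    exact ha (by rw [h1, h0, zero_mul])
  have hcop : IsCoprime a' c' := by
    rw [← gcd_isUnit_iff]
    exact h3
  have h' : a' * a' * b = c' * c' * d := by
    apply mul_left_cancel₀ (pow_ne_zero 2 he)
    rw [h1, h2] at h
    linear_combination h
  have ha' : IsUnit a' := hd a' <|
    ((hcop.mul_right hcop).mul_left (hcop.mul_right hcop)).dvd_of_dvd_mul_left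
      (h' ▸ dvd_mul_right _ _)
  have hc' : IsUnit c' := hb c' <|
    ((hcop.symm.mul_right hcop.symm).mul_left (hcop.symm.mul_right hcop.symm)).dvd_of_dvd_mul_left
      (h'.symm ▸ dvd_mul_right _ _)
  rw [h1, h2]
  exact (associated_mul_unit_left _ _ ha').trans (associated_mul_unit_right _ _ hc')

lemma exists_sq_mul_squarefree {K : Type} [Field K] (N : ℕ) :
    ∀ f ∈ monicDeg K N,
    ∃ a b : Polynomial K, a.Monic ∧ b.Monic ∧ Squarefree b ∧ a ^ 2 * b = f := by
  induction N using Nat.strong_induction_on with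
  | _ N ih =>
  rintro f ⟨hf, rfl⟩
  by_cases hs : Squarefree f
  · exact ⟨1, f, monic_one, hf, hs, by simp⟩
  · rw [squarefree_iff_no_irreducibles hf.ne_zero] at hs
    push Not at hs
    obtain ⟨x, hx, hxf⟩ := hs
    have hy : (normalize x).Monic := monic_normalize hx.ne_zero
    have hass : Associated (normalize x) x := normalize_associated x
    have hyf : normalize x * normalize x ∣ f := (hass.mul_mul hass).dvd.trans hxf
    have hyi : Irreducible (normalize x) := hass.symm.irreducible hx
    obtain ⟨h, rfl⟩ := hyf
    have hh : h.Monic := (hy.mul hy).of_mul_monic_left hf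
    have hdeg : h.natDegree < (normalize x * normalize x * h).natDegree := by
      rw [(hy.mul hy).natDegree_mul hh, hy.natDegree_mul hy]
      have := hyi.natDegree_pos
      omega
    obtain ⟨a, b, ha, hb, hbs, rfl⟩ := ih _ hdeg h ⟨hh, rfl⟩
    exact ⟨normalize x * a, b, hy.mul ha, hb, hbs, by ring⟩

lemma ncard_monicDeg (N : ℕ) : (monicDeg Fq N).ncard = Fintype.card Fq ^ N := by
  have e := (monicEquivDegreeLT (R := Fq) N).trans (degreeLTEquiv Fq N).toEquiv
  have h : Nat.card (monicDeg Fq N) = Nat.card (Fin N → Fq) := Nat.card_congr e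
  rw [← Nat.card_coe_set_eq, h]
  simp

lemma finite_monicDeg (N : ℕ) : (monicDeg Fq N).Finite := by
  apply Set.finite_of_ncard_pos
  rw [ncard_monicDeg]
  exact pow_pos Fintype.card_pos _

lemma finite_squarefreeCoprime (R : Finset (Polynomial Fq)) (N : ℕ) :
    (squarefreeCoprime R N).Finite :=
  (finite_monicDeg N).subset fun _ h => h.1

lemma sum_ncard_squarefree (N : ℕ) :
    ∑ i ∈ Finset.range (N / 2 + 1),
      Fintype.card Fq ^ i * (squarefreeCoprime (∅ : Finset (Polynomial Fq)) (N - 2 * i)).ncard =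
      Fintype.card Fq ^ N := by
  let F (i : ℕ) : Finset (Polynomial Fq × Polynomial Fq) :=
    (finite_monicDeg i).toFinset ×ˢ
      (finite_squarefreeCoprime (∅ : Finset (Polynomial Fq)) (N - 2 * i)).toFinset
  have hF : ∀ i, (F i).card = Fintype.card Fq ^ i *
      (squarefreeCoprime (∅ : Finset (Polynomial Fq)) (N - 2 * i)).ncard := by
    intro i
    rw [Finset.card_product, ← Set.ncard_eq_toFinset_card _ (finite_monicDeg i),
      ← Set.ncard_eq_toFinset_card _ (finite_squarefreeCoprime _ _), ncard_monicDeg]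
  simp_rw [← hF]
  rw [← Finset.card_sigma, ← ncard_monicDeg, Set.ncard_eq_toFinset_card _ (finite_monicDeg N)]
  refine Finset.card_bij (fun x _ => x.2.1 ^ 2 * x.2.2) ?_ ?_ ?_
  · rintro ⟨i, a, b⟩ h
    simp only [F, Finset.mem_sigma, Finset.mem_range, Finset.mem_product,
      Set.Finite.mem_toFinset, squarefreeCoprime, monicDeg, Set.mem_ofPred_eq] at h ⊢
    obtain ⟨hi, ⟨ha, rfl⟩, ⟨hb, hd⟩, -⟩ := h
    refine ⟨(ha.pow 2).mul hb, ?_⟩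
    rw [(ha.pow 2).natDegree_mul hb, ha.natDegree_pow, hd]
    omega
  · rintro ⟨i, a, b⟩ h ⟨j, c, d⟩ h' heq
    simp only [F, Finset.mem_sigma, Finset.mem_range, Finset.mem_product,
      Set.Finite.mem_toFinset, squarefreeCoprime, monicDeg, Set.mem_ofPred_eq] at h h' heq
    obtain ⟨hi, ⟨ha, rfl⟩, -, hb, -⟩ := h
    obtain ⟨hj, ⟨hc, rfl⟩, -, hd, -⟩ := h'
    obtain rfl := eq_of_monic_of_associated ha hc
      (associated_of_sq_mul_squarefree_eq hb hd ha.ne_zero heq)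
    obtain rfl := mul_left_cancel₀ (pow_ne_zero 2 ha.ne_zero) heq
    rfl
  · intro f hf
    rw [Set.Finite.mem_toFinset] at hf
    obtain ⟨a, b, ha, hb, hbs, rfl⟩ := exists_sq_mul_squarefree N f hf
    have hN := hf.2
    rw [(ha.pow 2).natDegree_mul hb, ha.natDegree_pow] at hN
    refine ⟨⟨a.natDegree, a, b⟩, ?_, rfl⟩
    simp only [F, Finset.mem_sigma, Finset.mem_range, Finset.mem_product,
      Set.Finite.mem_toFinset, squarefreeCoprime, monicDeg, Set.mem_ofPred_eq]
    exact ⟨by omega, ⟨ha, trivial⟩, ⟨hb, by omega⟩, hbs, by simp⟩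

lemma ncard_squarefree_add_two (N : ℕ) :
    (squarefreeCoprime (∅ : Finset (Polynomial Fq)) (N + 2)).ncard + Fintype.card Fq ^ (N + 1) =
      Fintype.card Fq ^ (N + 2) := by
  rw [← sum_ncard_squarefree (N + 2), Nat.add_div_right N two_pos, Finset.sum_range_succ',
    pow_succ', ← sum_ncard_squarefree N, Finset.mul_sum, add_comm]
  congr 1
  · refine Finset.sum_congr rfl fun i _ => ?_
    rw [show N + 2 - 2 * (i + 1) = N - 2 * i by omega, pow_succ']
    ring
  · rw [pow_zero, one_mul, mul_zero, Nat.sub_zero]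

lemma ncard_squarefreeCoprime_insert {R : Finset (Polynomial Fq)} {P : Polynomial Fq}
    (hR : ∀ Q ∈ R, Q.Monic ∧ Irreducible Q) (hPm : P.Monic) (hP : Irreducible P) (hPR : P ∉ R)
    (N : ℕ) :
    (squarefreeCoprime R (N + P.natDegree)).ncard =
      (squarefreeCoprime (insert P R) (N + P.natDegree)).ncard +
        (squarefreeCoprime (insert P R) N).ncard := by
  have key : squarefreeCoprime R (N + P.natDegree) =
      squarefreeCoprime (insert P R) (N + P.natDegree) ∪
        (fun E => P * E) '' squarefreeCoprime (insert P R) N := by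
    ext D
    simp only [squarefreeCoprime, monicDeg, Set.mem_union, Set.mem_image, Set.mem_ofPred_eq,
      Finset.forall_mem_insert]
    constructor
    · rintro ⟨⟨hD, hdeg⟩, hs, hc⟩
      by_cases hPD : P ∣ D
      · right
        obtain ⟨E, rfl⟩ := hPD
        have hE : E.Monic := hPm.of_mul_monic_left hD
        have hs' := squarefree_mul_iff.mp hs
        rw [hPm.natDegree_mul hE] at hdeg
        exact ⟨E, ⟨⟨hE, by omega⟩, hs'.2.2, (hP.isRelPrime_iff_not_dvd).mp hs'.1,
          fun Q hQ h => hc Q hQ (h.mul_left P)⟩, rfl⟩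
      · exact Or.inl ⟨⟨hD, hdeg⟩, hs, hPD, hc⟩
    · rintro (⟨hD, hs, -, hc⟩ | ⟨E, ⟨⟨hE, hdeg⟩, hs, hPE, hc⟩, rfl⟩)
      · exact ⟨hD, hs, hc⟩
      · refine ⟨⟨hPm.mul hE, by rw [hPm.natDegree_mul hE]; omega⟩,
          squarefree_mul_iff.mpr ⟨(hP.isRelPrime_iff_not_dvd).mpr hPE, hP.squarefree, hs⟩, ?_⟩
        intro Q hQ hdvd
        rcases (hR Q hQ).2.prime.dvd_or_dvd hdvd with h | h
        · have := eq_of_monic_of_associated (hR Q hQ).1 hPm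
            ((hR Q hQ).2.associated_of_dvd hP h)
          exact hPR (this ▸ hQ)
        · exact hc Q hQ h
  rw [key, Set.ncard_union_eq _ (finite_squarefreeCoprime _ _)
    ((finite_squarefreeCoprime _ _).image _),
    Set.ncard_image_of_injective _ (mul_right_injective₀ hP.ne_zero)]
  rw [Set.disjoint_left]
  rintro _ h ⟨E, -, rfl⟩
  exact h.2.2 P (Finset.mem_insert_self _ _) (dvd_mul_right _ _)

lemma squarefreeCoprime_insert_of_lt {K : Type} [Field K] {R : Finset (Polynomial K)}
    {P : Polynomial K}
    {N : ℕ} (hN : N < P.natDegree) :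
    squarefreeCoprime (insert P R) N = squarefreeCoprime R N := by
  ext D
  simp only [squarefreeCoprime, monicDeg, Set.mem_ofPred_eq, Finset.forall_mem_insert]
  refine ⟨fun ⟨h, hs, _, hc⟩ => ⟨h, hs, hc⟩, fun ⟨h, hs, hc⟩ => ⟨h, hs, fun hd => ?_, hc⟩⟩
  have := natDegree_le_of_dvd hd h.1.ne_zero
  omega

/-- Approximating `F N` by `s ^ (2 * N) * (M * (1 + s ^ (-2 d)))` transfers to the solution `G` of
`F (N + d) = G (N + d) + G N`. -/
lemma abs_sub_le_of_recurrence {s M C : ℝ} {d : ℕ} {F G : ℕ → ℝ} (hs : 4 / 3 ≤ s) (hd : d ≠ 0)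
    (hM0 : 0 ≤ M) (hM1 : M ≤ 1) (hC : 1 ≤ C)
    (hF : ∀ N, |F N - s ^ (2 * N) * (M * (1 + (s ^ (2 * d))⁻¹))| ≤ C * s ^ N)
    (hlt : ∀ N < d, G N = F N) (hadd : ∀ N, F (N + d) = G (N + d) + G N) (N : ℕ) :
    |G N - s ^ (2 * N) * M| ≤ 4 * C * s ^ N := by
  have hs0 : 0 < s := by linarith
  have hsd : 4 / 3 ≤ s ^ d := hs.trans (le_self_pow₀ (by linarith) hd)
  induction N using Nat.strong_induction_on with
  | _ N ih =>
  have hsN : 0 < s ^ N := by positivity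
  rcases lt_or_ge N d with h | h
  · have hpow : s ^ (2 * N) * (s ^ (2 * d))⁻¹ ≤ s ^ N := by
      rw [← div_eq_mul_inv, div_le_iff₀ (by positivity), ← pow_add]
      exact pow_le_pow_right₀ (by linarith) (by omega)
    have hpow0 : 0 ≤ s ^ (2 * N) * (s ^ (2 * d))⁻¹ := by positivity
    have h1 : s ^ (2 * N) * (s ^ (2 * d))⁻¹ * M ≤ s ^ N := by nlinarith
    have h2 : 0 ≤ s ^ (2 * N) * (s ^ (2 * d))⁻¹ * M := by positivity
    have h3 := abs_le.mp (hF N)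
    rw [hlt N h, abs_le]
    constructor <;> nlinarith
  · obtain ⟨k, rfl⟩ := Nat.exists_eq_add_of_le' h
    have h1 := abs_le.mp (hF (k + d))
    have h2 := abs_le.mp (ih k (by omega))
    have h3 : s ^ (2 * (k + d)) * (M * (1 + (s ^ (2 * d))⁻¹)) =
        s ^ (2 * (k + d)) * M + s ^ (2 * k) * M := by
      rw [mul_add, pow_add]
      field_simp
    have h4 : C * s ^ k * (4 / 3) ≤ C * s ^ k * s ^ d := by gcongr
    rw [h3, hadd] at h1
    rw [pow_add] at h1 ⊢
    rw [abs_le]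
    constructor <;> nlinarith

lemma abs_ncard_squarefree_sub_le (N : ℕ) :
    |((squarefreeCoprime (∅ : Finset (Polynomial Fq)) N).ncard : ℝ)
        - (Fintype.card Fq : ℝ) ^ N * (1 - 1 / (Fintype.card Fq : ℝ))|
      ≤ Real.sqrt (Fintype.card Fq) ^ N := by
  have hq : (2 : ℝ) ≤ Fintype.card Fq := by exact_mod_cast Fintype.one_lt_card (α := Fq)
  have hs : 1 ≤ Real.sqrt (Fintype.card Fq) := Real.one_le_sqrt.mpr (by linarith)
  have h0 := fun M => sum_ncard_squarefree (Fq := Fq) M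
  match N with
  | 0 =>
    have h : ((squarefreeCoprime (∅ : Finset (Polynomial Fq)) 0).ncard : ℝ) = 1 := by
      have := h0 0
      simp only [Nat.zero_div, zero_add, Finset.range_one, Finset.sum_singleton, pow_zero,
        one_mul, mul_zero, Nat.sub_zero] at this
      exact_mod_cast this
    rw [h]
    have h1 : 0 ≤ 1 / (Fintype.card Fq : ℝ) := by positivity
    have h2 : 1 / (Fintype.card Fq : ℝ) ≤ 1 := by
      rw [div_le_one (by linarith)]
      linarith
    simp only [pow_zero, one_mul]
    rw [abs_le]
    constructor <;> linarith
  | 1 =>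
    have h : ((squarefreeCoprime (∅ : Finset (Polynomial Fq)) 1).ncard : ℝ) =
        Fintype.card Fq := by
      have := h0 1
      simp only [Nat.reduceDiv, zero_add, Finset.range_one, Finset.sum_singleton, pow_zero,
        one_mul, mul_zero, Nat.sub_zero, pow_one] at this
      exact_mod_cast this
    rw [h, pow_one, pow_one, mul_sub, mul_one_div_cancel (by linarith)]
    simpa using hs
  | M + 2 =>
    have h : ((squarefreeCoprime (∅ : Finset (Polynomial Fq)) (M + 2)).ncard : ℝ) +
        (Fintype.card Fq : ℝ) ^ (M + 1) = (Fintype.card Fq : ℝ) ^ (M + 2) := by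
      exact_mod_cast ncard_squarefree_add_two (Fq := Fq) M
    have h1 : (Fintype.card Fq : ℝ) ^ (M + 2) * (1 - 1 / (Fintype.card Fq : ℝ)) =
        (Fintype.card Fq : ℝ) ^ (M + 2) - (Fintype.card Fq : ℝ) ^ (M + 1) := by
      rw [pow_succ _ (M + 1)]
      field_simp
    rw [h1, ← h]
    simp only [add_sub_cancel_right, sub_self, abs_zero]
    positivity

lemma pnorm_of_monic {f : Polynomial Fq} (hf : f.Monic) :
    pnorm f = (Fintype.card Fq : ℝ) ^ f.natDegree :=
  if_neg hf.ne_zero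

lemma pnorm_nonneg (f : Polynomial Fq) : 0 ≤ pnorm f := by
  unfold pnorm
  split_ifs <;> positivity

/-- The count of square-free polynomials coprime to a finite set of primes, with an error term
uniform in the primes up to their number. -/
lemma abs_ncard_squarefreeCoprime_sub_le (R : Finset (Polynomial Fq))
    (hR : ∀ P ∈ R, P.Monic ∧ Irreducible P) (N : ℕ) :
    |((squarefreeCoprime R N).ncard : ℝ)
        - (Fintype.card Fq : ℝ) ^ N * (1 - 1 / (Fintype.card Fq : ℝ)) *
          ∏ P ∈ R, pnorm P / (pnorm P + 1)|
      ≤ 4 ^ R.card * Real.sqrt (Fintype.card Fq) ^ N := by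
  have hq : (2 : ℝ) ≤ Fintype.card Fq := by exact_mod_cast Fintype.one_lt_card (α := Fq)
  have hs : 4 / 3 ≤ Real.sqrt (Fintype.card Fq) := Real.le_sqrt_of_sq_le (by linarith)
  have hsq (k : ℕ) : Real.sqrt (Fintype.card Fq) ^ (2 * k) = (Fintype.card Fq : ℝ) ^ k := by
    rw [pow_mul, Real.sq_sqrt (by linarith)]
  have hκ0 : 0 ≤ 1 - 1 / (Fintype.card Fq : ℝ) := by
    rw [sub_nonneg, div_le_one (by linarith)]
    linarith
  have hκ1 : 1 - 1 / (Fintype.card Fq : ℝ) ≤ 1 := by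
    have : 0 ≤ 1 / (Fintype.card Fq : ℝ) := by positivity
    linarith
  induction R using Finset.induction_on generalizing N with
  | empty => simpa using abs_ncard_squarefree_sub_le (Fq := Fq) N
  | insert P R hPR ih =>
    have hR' : ∀ Q ∈ R, Q.Monic ∧ Irreducible Q := fun Q hQ => hR Q (Finset.mem_insert_of_mem hQ)
    obtain ⟨hPm, hP⟩ := hR P (Finset.mem_insert_self _ _)
    have ha0 : 0 ≤ ∏ Q ∈ insert P R, pnorm Q / (pnorm Q + 1) :=
      Finset.prod_nonneg fun Q _ => div_nonneg (pnorm_nonneg Q) (by linarith [pnorm_nonneg Q])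
    have ha1 : ∏ Q ∈ insert P R, pnorm Q / (pnorm Q + 1) ≤ 1 := by
      refine Finset.prod_le_one
        (fun Q _ => div_nonneg (pnorm_nonneg Q) (by linarith [pnorm_nonneg Q])) fun Q _ => ?_
      rw [div_le_one (by linarith [pnorm_nonneg Q])]
      linarith
    have hp : (0 : ℝ) < (Fintype.card Fq : ℝ) ^ P.natDegree := by positivity
    have key := abs_sub_le_of_recurrence (s := Real.sqrt (Fintype.card Fq))
      (M := (1 - 1 / (Fintype.card Fq : ℝ)) * ∏ Q ∈ insert P R, pnorm Q / (pnorm Q + 1))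
      (C := 4 ^ R.card) (d := P.natDegree)
      (F := fun k => ((squarefreeCoprime R k).ncard : ℝ))
      (G := fun k => ((squarefreeCoprime (insert P R) k).ncard : ℝ))
      hs hP.natDegree_pos.ne' (mul_nonneg hκ0 ha0) (mul_le_one₀ hκ1 ha0 ha1)
      (one_le_pow₀ (by norm_num)) ?_ ?_ ?_ N
    · rw [Finset.card_insert_of_notMem hPR, pow_succ', mul_assoc (_ ^ N), ← hsq]
      exact key
    · intro k
      convert ih hR' k using 3
      rw [Finset.prod_insert hPR, pnorm_of_monic hPm, hsq, hsq]
      field_simp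
    · intro k hk
      simp only [squarefreeCoprime_insert_of_lt hk]
    · intro k
      exact_mod_cast ncard_squarefreeCoprime_insert hR' hPm hP hPR k

lemma sum_natDegree_le_of_dvd {K : Type*} [Field K] {n : Polynomial K} (hn : n ≠ 0)
    {R : Finset (Polynomial K)} (hR : ∀ P ∈ R, Irreducible P ∧ P.Monic ∧ P ∣ n) :
    ∑ P ∈ R, P.natDegree ≤ n.natDegree := by
  rw [← natDegree_prod_of_monic _ _ fun P hP => (hR P hP).2.1]
  refine natDegree_le_of_dvd (Finset.prod_dvd_of_coprime ?_ fun P hP => (hR P hP).2.2) hn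
  intro P hP Q hQ hPQ
  refine ((hR P hP).1.coprime_iff_not_dvd).mpr fun h => hPQ ?_
  exact eq_of_monic_of_associated (hR P hP).2.1 (hR Q hQ).2.1
    ((hR P hP).1.associated_of_dvd (hR Q hQ).1 h)

/-- A quantity exponential in the number of prime divisors of `n` is `O(|n| ^ ε)`. -/
lemma exists_four_pow_card_le (Fq : Type) [Field Fq] [Fintype Fq] {ε : ℝ} (hε : 0 < ε) :
    ∃ C : ℝ, 0 < C ∧ ∀ (n : Polynomial Fq) (R : Finset (Polynomial Fq)), n.Monic →
      (∀ P ∈ R, Irreducible P ∧ P.Monic ∧ P ∣ n) → (4 : ℝ) ^ R.card ≤ C * pnorm n ^ ε := by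
  have hq : (1 : ℝ) < Fintype.card Fq := by exact_mod_cast Fintype.one_lt_card (α := Fq)
  have hb : 1 < (Fintype.card Fq : ℝ) ^ ε := Real.one_lt_rpow hq hε
  obtain ⟨k, hk⟩ := pow_unbounded_of_one_lt 4 hb
  let A : Finset (Polynomial Fq) :=
    (Finset.range k).biUnion fun i => (finite_monicDeg i).toFinset
  refine ⟨4 ^ A.card, by positivity, fun n R hn hR => ?_⟩
  rw [pnorm_of_monic hn, ← Real.rpow_pow_comm (by positivity),
    ← Finset.card_filter_add_card_filter_not (s := R) (fun P => P.natDegree < k), pow_add]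
  gcongr
  · norm_num
  · intro P hP
    rw [Finset.mem_filter] at hP
    exact Finset.mem_biUnion.mpr ⟨P.natDegree, Finset.mem_range.mpr hP.2,
      (Set.Finite.mem_toFinset _).mpr ⟨(hR P hP.1).2.1, rfl⟩⟩
  · set B := R.filter fun P => ¬ P.natDegree < k
    have hB : B.card * k ≤ n.natDegree :=
      calc B.card * k ≤ ∑ P ∈ B, P.natDegree :=
            Finset.card_nsmul_le_sum _ _ _ fun P hP => not_lt.mp (Finset.mem_filter.mp hP).2
        _ ≤ ∑ P ∈ R, P.natDegree := Finset.sum_le_sum_of_subset (Finset.filter_subset _ _)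
        _ ≤ n.natDegree := sum_natDegree_le_of_dvd hn.ne_zero hR
    calc (4 : ℝ) ^ B.card ≤ (((Fintype.card Fq : ℝ) ^ ε) ^ k) ^ B.card := by gcongr
      _ = ((Fintype.card Fq : ℝ) ^ ε) ^ (B.card * k) := by rw [← pow_mul, mul_comm]
      _ ≤ _ := pow_le_pow_right₀ hb.le hB

lemma quadCharP_mul_self {K : Type} [Field K] (D P : Polynomial K) :
    quadCharP D P * quadCharP D P = if P ∣ D then 0 else 1 := by
  unfold quadCharP
  split_ifs <;> simp

lemma quadCharP_congr {K : Type} [Field K] (D : Polynomial K) {P Q : Polynomial K}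
    (h : Associated P Q) : quadCharP D P = quadCharP D Q := by
  unfold quadCharP
  simp only [h.dvd_iff_dvd_left]

lemma jacobi_sq {K : Type} [Field K] (D : Polynomial K) {m : Polynomial K} (hm : m ≠ 0) :
    jacobi D (m ^ 2) =
      if ∀ P ∈ (UniqueFactorizationMonoid.normalizedFactors (m ^ 2)).toFinset, ¬ P ∣ D
      then 1 else 0 := by
  have hrel : (UniqueFactorizationMonoid.factors (m ^ 2)).map (quadCharP D) =
      (UniqueFactorizationMonoid.factors m + UniqueFactorizationMonoid.factors m).map
        (quadCharP D) := by
    rw [← Multiset.rel_eq, Multiset.rel_map, sq]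
    exact (UniqueFactorizationMonoid.factors_mul hm hm).mono
      fun P _ Q _ h => quadCharP_congr D h
  have hprod (s : Multiset (Polynomial K)) :
      (s.map (quadCharP D)).prod * (s.map (quadCharP D)).prod =
        if ∀ P ∈ s, ¬ P ∣ D then 1 else 0 := by
    induction s using Multiset.induction_on with
    | empty => simp
    | cons P s ih =>
      rw [Multiset.map_cons, Multiset.prod_cons, mul_mul_mul_comm, ih, quadCharP_mul_self]
      simp only [Multiset.mem_cons, forall_eq_or_imp]
      split_ifs <;> simp_all
  rw [jacobi, hrel, Multiset.map_add, Multiset.prod_add, hprod]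
  suffices hiff : (∀ P ∈ UniqueFactorizationMonoid.factors m, ¬ P ∣ D) ↔
      ∀ P ∈ (UniqueFactorizationMonoid.normalizedFactors (m ^ 2)).toFinset, ¬ P ∣ D by
    by_cases h : ∀ P ∈ UniqueFactorizationMonoid.factors m, ¬ P ∣ D
    · rw [if_pos h, if_pos (hiff.mp h)]
    · rw [if_neg h, if_neg (mt hiff.mpr h)]
  simp only [Multiset.mem_toFinset]
  constructor
  · intro h P hP hPD
    rw [Polynomial.mem_normalizedFactors_iff (pow_ne_zero 2 hm)] at hP
    obtain ⟨Q, hQ, hPQ⟩ := UniqueFactorizationMonoid.exists_mem_factors_of_dvd hm hP.1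
      (hP.1.prime.dvd_of_dvd_pow hP.2.2)
    exact h Q hQ (hPQ.symm.dvd.trans hPD)
  · intro h P hP hPD
    have hPi := UniqueFactorizationMonoid.irreducible_of_factor P hP
    have hass : Associated (normalize P) P := normalize_associated P
    refine h (normalize P) ((Polynomial.mem_normalizedFactors_iff (pow_ne_zero 2 hm)).mpr
      ⟨hass.symm.irreducible hPi, monic_normalize hPi.ne_zero, ?_⟩) (hass.dvd.trans hPD)
    exact (hass.dvd.trans (UniqueFactorizationMonoid.dvd_of_mem_factors hP)).trans
      (dvd_pow_self m two_ne_zero)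

lemma finsum_jacobi_sq (g : ℕ) {m : Polynomial Fq} (hm : m ≠ 0) :
    ∑ᶠ D ∈ Hset Fq g, (jacobi D (m ^ 2) : ℝ) =
      (squarefreeCoprime (UniqueFactorizationMonoid.normalizedFactors (m ^ 2)).toFinset
        (2 * g + 1)).ncard := by
  have hfin : (Hset Fq g).Finite :=
    (finite_monicDeg (2 * g + 1)).subset fun D h => ⟨h.1, h.2.2⟩
  rw [finsum_mem_eq_finite_toFinset_sum _ hfin,
    Set.ncard_eq_toFinset_card _ (finite_squarefreeCoprime _ _)]
  simp only [jacobi_sq _ hm, Int.cast_ite, Int.cast_one, Int.cast_zero]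
  rw [Finset.sum_boole]
  congr 2
  ext D
  simp only [Finset.mem_filter, Set.Finite.mem_toFinset, squarefreeCoprime, Hset, monicDeg,
    Set.mem_ofPred_eq]
  tauto

lemma am_eq_prod {n : Polynomial Fq} (hn : n ≠ 0) :
    am n = ∏ P ∈ (UniqueFactorizationMonoid.normalizedFactors n).toFinset,
      pnorm P / (pnorm P + 1) := by
  rw [am, ← finprod_mem_finset_eq_prod]
  refine finprod_congr fun P => finprod_congr_Prop ?_ fun _ => rfl
  rw [Multiset.mem_toFinset, Polynomial.mem_normalizedFactors_iff hn]
  exact propext and_left_comm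

/-- character sum over `H_{2g+1}` for square `n`. -/
theorem char_sum_square (ε : ℝ) (hε : 0 < ε) :
    ∃ C : ℝ, 0 < C ∧ ∀ (g : ℕ) (n : Polynomial Fq), n.Monic →
      (∃ m : Polynomial Fq, n = m ^ 2) →
        |(∑ᶠ D ∈ Hset Fq g, (jacobi D n : ℝ))
            - (Fintype.card Fq : ℝ) ^ (2 * g + 1) * (1 - 1 / (Fintype.card Fq : ℝ)) * am n|
          ≤ C * Real.sqrt ((Fintype.card Fq : ℝ) ^ (2 * g + 1)) * pnorm n ^ ε := by
  obtain ⟨C, hC, h⟩ := exists_four_pow_card_le Fq hε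
  refine ⟨C, hC, ?_⟩
  rintro g _ hn ⟨m, rfl⟩
  have hR : ∀ P ∈ (UniqueFactorizationMonoid.normalizedFactors (m ^ 2)).toFinset,
      Irreducible P ∧ P.Monic ∧ P ∣ m ^ 2 := fun P hP =>
    (Polynomial.mem_normalizedFactors_iff hn.ne_zero).mp (Multiset.mem_toFinset.mp hP)
  have hm : m ≠ 0 := fun h0 => hn.ne_zero (by rw [h0, zero_pow two_ne_zero])
  have hsqrt : Real.sqrt ((Fintype.card Fq : ℝ) ^ (2 * g + 1)) =
      Real.sqrt (Fintype.card Fq) ^ (2 * g + 1) := by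
    rw [Real.sqrt_eq_iff_mul_self_eq (by positivity) (by positivity), ← mul_pow,
      Real.mul_self_sqrt (by positivity)]
  rw [finsum_jacobi_sq g hm, am_eq_prod hn.ne_zero, hsqrt, mul_right_comm C]
  refine (abs_ncard_squarefreeCoprime_sub_le _
    (fun P hP => ⟨(hR P hP).2.1, (hR P hP).1⟩) _).trans ?_
  gcongr
  exact h _ _ hn hR
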